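/- For every real number q in the interval [-0.40, -0.35], the virtual edge interaction of H_5 satisfies ŷ_5(q) < -1 (in particular S(H_5;q) ≠ 0 on this interval). -/

import Mathlib

open SimpleGraph Finset

noncomputable section

/-- The finset of edges of a simple graph on a finite vertex type. -/
def edgeFin {V : Type} [Finite V] (G : SimpleGraph V) : Finset (Sym2 V) :=
  (Set.toFinite G.edgeSet).toFinset

open Classical in
/-- All-terminal reliability polynomial: `relPoly G q` is the probability that the graph stays
connected when every edge fails independently with probability `q`. -/
def relPoly {V : Type} [Finite V] (G : SimpleGraph V) (q : ℝ) : ℝ :=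
  ∑ A ∈ (edgeFin G).powerset,
    if (SimpleGraph.fromEdgeSet (A : Set (Sym2 V))).Connected then
      (1 - q) ^ A.card * q ^ ((edgeFin G).card - A.card) else 0

open Classical in
/-- Split reliability polynomial with terminals `u`, `v`: the sum is over edge subsets whose
spanning subgraph has exactly two components, one containing `u` and the other containing `v`. -/
def splitRel {V : Type} [Finite V] (H : SimpleGraph V) (u v : V) (q : ℝ) : ℝ :=
  ∑ A ∈ (edgeFin H).powerset,
    if (¬ (SimpleGraph.fromEdgeSet (A : Set (Sym2 V))).Reachable u v ∧
        ∀ w, (SimpleGraph.fromEdgeSet (A : Set (Sym2 V))).Reachable u w ∨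
             (SimpleGraph.fromEdgeSet (A : Set (Sym2 V))).Reachable v w) then
      (1 - q) ^ A.card * q ^ ((edgeFin H).card - A.card) else 0

/-- The virtual edge interaction `ŷ_H = Rel(H)/S(H) + 1`. -/
def yhat {V : Type} [Finite V] (H : SimpleGraph V) (u v : V) (q : ℝ) : ℝ :=
  relPoly H q / splitRel H u v q + 1

/-- `Hgraph n` is the complete graph on `Fin n` with the edge between `0` and `1` removed
(for `n ≥ 2`; for `n < 2` no edge is removed). -/
def Hgraph (n : ℕ) : SimpleGraph (Fin n) :=
  (⊤ : SimpleGraph (Fin n)).deleteEdges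
    {e | ∃ _h : 2 ≤ n, e = s(⟨0, by omega⟩, ⟨1, by omega⟩)}

/-- `Cfun n q = Rel(K_n; q)`. -/
def Cfun (n : ℕ) (q : ℝ) : ℝ := relPoly (⊤ : SimpleGraph (Fin n)) q

/-- `Rfun n q = Rel(H_n; q)` where `H_n = K_n` minus an edge. -/
def Rfun (n : ℕ) (q : ℝ) : ℝ := relPoly (Hgraph n) q

/-- `Sfun n q = S(H_n; q)`, the split reliability of `K_n` minus the edge `uv`,
with terminals `u`, `v` the endpoints of the deleted edge. -/
def Sfun (n : ℕ) (q : ℝ) : ℝ :=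
  if h : 2 ≤ n then splitRel (Hgraph n) ⟨0, by omega⟩ ⟨1, by omega⟩ q else 0

/-- `yfun n q = ŷ_{H_n}(q)`. -/
def yfun (n : ℕ) (q : ℝ) : ℝ := Rfun n q / Sfun n q + 1

/-- Every vertex is reachable from `T` iff every proper vertex set containing `T` is left by some
edge. -/
lemma forall_exists_reachable_iff_forall_cut {V : Type*} [Fintype V] (G : SimpleGraph V)
    (T : Finset V) :
    (∀ w, ∃ t ∈ T, G.Reachable t w) ↔
      ∀ S : Finset V, T ⊆ S → S ≠ Finset.univ → ∃ v ∈ S, ∃ w ∉ S, G.Adj v w := by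
  classical
  constructor
  · intro h S hTS hS
    obtain ⟨w, hw⟩ : ∃ w, w ∉ S := by
      by_contra! hall
      exact hS (Finset.eq_univ_iff_forall.2 hall)
    obtain ⟨t, ht, ⟨p⟩⟩ := h w
    obtain ⟨d, -, hd₁, hd₂⟩ := p.exists_boundary_dart (S : Set V) (hTS ht) hw
    exact ⟨d.fst, hd₁, d.snd, hd₂, d.adj⟩
  · intro h w
    by_contra hw
    obtain ⟨a, ha, b, hb, hab⟩ := h {x | ∃ t ∈ T, G.Reachable t x}
      (fun t ht => by simpa using ⟨t, ht, Reachable.refl t⟩)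
      (fun hS => hw (by simpa using Finset.eq_univ_iff_forall.1 hS w))
    simp only [Finset.mem_filter, Finset.mem_univ, true_and] at ha hb
    obtain ⟨t, ht, hta⟩ := ha
    exact hb ⟨t, ht, hta.trans hab.reachable⟩

/-- The endpoints of the nine edges of `Hgraph 5`. -/
def endpoints : Fin 9 → Fin 5 × Fin 5 :=
  ![(0, 2), (0, 3), (0, 4), (1, 2), (1, 3), (1, 4), (2, 3), (2, 4), (3, 4)]

/-- The nine edges of `Hgraph 5`. -/
def edgeEmb : Fin 9 ↪ Sym2 (Fin 5) where
  toFun i := s((endpoints i).1, (endpoints i).2)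
  inj' := by unfold Function.Injective; decide +kernel

lemma edgeFin_Hgraph_five : edgeFin (Hgraph 5) = Finset.univ.map edgeEmb := by
  have key : ∀ a b : Fin 5, (a ≠ b ∧ s(a, b) ≠ s(0, 1)) ↔ ∃ i, edgeEmb i = s(a, b) := by
    decide +kernel
  ext e
  induction e with | _ a b =>
  simp [edgeFin, Hgraph, ← key]

/-- The edges indexed by `B` connect every vertex to `T`, expressed through cuts. -/
def Spans (T : Finset (Fin 5)) (B : Finset (Fin 9)) : Prop :=
  ∀ S : Finset (Fin 5), T ⊆ S → S ≠ Finset.univ → ∃ i ∈ B,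
    (endpoints i).1 ∈ S ∧ (endpoints i).2 ∉ S ∨ (endpoints i).2 ∈ S ∧ (endpoints i).1 ∉ S

instance (T : Finset (Fin 5)) : DecidablePred (Spans T) := fun B => by
  unfold Spans; infer_instance

/-- The spanning subgraph of `Hgraph 5` with the edges indexed by `B`. -/
abbrev subgraphOf (B : Finset (Fin 9)) : SimpleGraph (Fin 5) :=
  SimpleGraph.fromEdgeSet ((B.map edgeEmb : Finset (Sym2 (Fin 5))) : Set (Sym2 (Fin 5)))

lemma spans_iff (T : Finset (Fin 5)) (B : Finset (Fin 9)) :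
    Spans T B ↔ ∀ w, ∃ t ∈ T, (subgraphOf B).Reachable t w := by
  rw [forall_exists_reachable_iff_forall_cut]
  refine forall₃_congr fun S _ _ => ⟨?_, ?_⟩
  · rintro ⟨i, hi, ⟨h₁, h₂⟩ | ⟨h₁, h₂⟩⟩
    · refine ⟨_, h₁, _, h₂, (SimpleGraph.fromEdgeSet_adj _).2 ⟨?_, ?_⟩⟩
      · exact Finset.mem_coe.2 (Finset.mem_map_of_mem edgeEmb hi)
      · exact ne_of_mem_of_not_mem h₁ h₂
    · refine ⟨_, h₁, _, h₂, (SimpleGraph.fromEdgeSet_adj _).2 ⟨?_, ?_⟩⟩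
      · rw [Sym2.eq_swap]
        exact Finset.mem_coe.2 (Finset.mem_map_of_mem edgeEmb hi)
      · exact ne_of_mem_of_not_mem h₁ h₂
  · rintro ⟨v, hv, w, hw, hvw⟩
    obtain ⟨i, hi, he⟩ := Finset.mem_map.1
      (Finset.mem_coe.1 ((SimpleGraph.fromEdgeSet_adj _).1 hvw).1)
    refine ⟨i, hi, ?_⟩
    rcases Sym2.eq_iff.1 he with ⟨h₁, h₂⟩ | ⟨h₁, h₂⟩
    · exact .inl ⟨h₁ ▸ hv, h₂ ▸ hw⟩
    · exact .inr ⟨h₂ ▸ hv, h₁ ▸ hw⟩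

lemma connected_subgraphOf_iff (B : Finset (Fin 9)) :
    (subgraphOf B).Connected ↔ Spans {0} B := by
  rw [spans_iff, SimpleGraph.connected_iff_exists_forall_reachable]
  simp only [Finset.mem_singleton, exists_eq_left]
  exact ⟨fun ⟨v, hv⟩ w => (hv 0).symm.trans (hv w), fun h => ⟨0, h⟩⟩

lemma split_subgraphOf_iff (B : Finset (Fin 9)) :
    (¬ (subgraphOf B).Reachable 0 1 ∧
      ∀ w, (subgraphOf B).Reachable 0 w ∨ (subgraphOf B).Reachable 1 w) ↔
      Spans {0, 1} B ∧ ¬ Spans {0} B := by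
  simp only [spans_iff, Finset.mem_insert, Finset.mem_singleton, exists_eq_or_imp,
    exists_eq_left]
  constructor
  · rintro ⟨h, hw⟩
    exact ⟨hw, fun h' => h (h' 1)⟩
  · rintro ⟨hw, h⟩
    exact ⟨fun h' => h fun w => (hw w).elim id h'.trans, hw⟩

lemma sum_powerset_map_univ {n : ℕ} {β : Type*} (e : Fin n ↪ β) (P : Finset β → Prop)
    {_ : DecidablePred P} (Q : Finset (Fin n) → Prop) [DecidablePred Q]
    (h : ∀ B : Finset (Fin n), P (B.map e) ↔ Q B) (x y : ℝ) :
    (∑ A ∈ (Finset.univ.map e).powerset,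
      if P A then x ^ A.card * y ^ ((Finset.univ.map e).card - A.card) else 0) =
    ∑ k ∈ Finset.range (n + 1),
      (((Finset.univ : Finset (Fin n)).powersetCard k).filter Q).card * (x ^ k * y ^ (n - k)) := by
  rw [Finset.sum_powerset]
  simp only [Finset.powersetCard_map, Finset.sum_map, Finset.card_map, Finset.card_univ,
    Fintype.card_fin, Finset.mapEmbedding_apply, RelEmbedding.coe_toEmbedding, h]
  refine Finset.sum_congr rfl fun k _ => ?_
  rw [← Finset.sum_filter, Finset.sum_congr rfl (g := fun _ => x ^ k * y ^ (n - k)),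
    Finset.sum_const, nsmul_eq_mul]
  intro B hB
  rw [(Finset.mem_powersetCard.1 (Finset.mem_filter.1 hB).1).2]

lemma card_spans (k : Fin 10) :
    (((Finset.univ : Finset (Fin 9)).powersetCard k).filter (Spans {0})).card =
      ![0, 0, 0, 0, 75, 111, 82, 36, 9, 1] k := by
  revert k; decide +kernel

lemma card_split (k : Fin 10) :
    (((Finset.univ : Finset (Fin 9)).powersetCard k).filter
      fun B => Spans {0, 1} B ∧ ¬ Spans {0} B).card = ![0, 0, 0, 50, 36, 12, 2, 0, 0, 0] k := by
  revert k; decide +kernel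

lemma Rfun_five (q : ℝ) :
    Rfun 5 q = (1 - q) ^ 4 * (1 + 4 * q + 10 * q ^ 2 + 18 * q ^ 3 + 24 * q ^ 4 + 18 * q ^ 5) := by
  rw [Rfun, relPoly, edgeFin_Hgraph_five]
  refine (sum_powerset_map_univ edgeEmb _ (Spans {0}) connected_subgraphOf_iff _ _).trans ?_
  rw [Finset.sum_range]
  simp only [card_spans, Fin.sum_univ_succ]
  simp
  ring

lemma Sfun_five (q : ℝ) :
    Sfun 5 q = (1 - q) ^ 3 * q ^ 3 * (2 + 6 * q + 18 * q ^ 2 + 24 * q ^ 3) := by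
  rw [Sfun, dif_pos (by norm_num), splitRel, edgeFin_Hgraph_five]
  refine (sum_powerset_map_univ edgeEmb _ (fun B => Spans {0, 1} B ∧ ¬ Spans {0} B)
    split_subgraphOf_iff _ _).trans ?_
  rw [Finset.sum_range]
  simp only [card_split, Fin.sum_univ_succ]
  simp
  ring

/-- On the interval `[-0.40, -0.35]` the virtual edge interaction of `H_5` is `< -1`
(in particular its split reliability is nonzero there). -/
theorem yhat_H5_lt_neg_one (q : ℝ) (hq : q ∈ Set.Icc (-0.40 : ℝ) (-0.35)) :
    Sfun 5 q ≠ 0 ∧ yfun 5 q < -1 := by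
  obtain ⟨h₁, h₂⟩ := hq
  norm_num at h₁ h₂
  have hp : 0 < 1 - q := by linarith
  have hq₀ : q < 0 := by linarith
  have hcube : q ^ 3 < 0 := Odd.pow_neg (by decide) hq₀
  have hcube' : -(8 / 125) ≤ q ^ 3 := by
    nlinarith [mul_nonneg (sub_nonneg.2 h₁) (sq_nonneg (q - 1 / 5))]
  have hB : 9 / 10 < 2 + 6 * q + 18 * q ^ 2 + 24 * q ^ 3 := by
    nlinarith [sq_nonneg (q + 2 / 5)]
  have hB' : 2 + 6 * q + 18 * q ^ 2 + 24 * q ^ 3 < 11 / 10 := by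
    nlinarith [mul_nonneg (sub_nonneg.2 h₁) (sub_nonneg.2 h₂),
      mul_nonneg (mul_nonneg (sub_nonneg.2 h₁) (sub_nonneg.2 h₂)) (neg_nonneg.2 hq₀.le)]
  have hA : 27 / 100 < 1 + 4 * q + 10 * q ^ 2 + 18 * q ^ 3 + 24 * q ^ 4 + 18 * q ^ 5 := by
    obtain ⟨x, rfl⟩ : ∃ x, q = x - 2 / 5 := ⟨q + 2 / 5, by ring⟩
    have hx₀ : 0 ≤ x := by linarith
    have hx₁ : x ≤ 1 / 20 := by linarith
    nlinarith [pow_nonneg hx₀ 2, pow_nonneg hx₀ 3, pow_nonneg hx₀ 4, pow_nonneg hx₀ 5,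
      mul_nonneg (pow_nonneg hx₀ 2) (sub_nonneg.2 hx₁),
      mul_nonneg (pow_nonneg hx₀ 3) (sub_nonneg.2 hx₁)]
  have hS : Sfun 5 q < 0 := by
    rw [Sfun_five]
    exact mul_neg_of_neg_of_pos (mul_neg_of_pos_of_neg (by positivity) hcube) (by linarith)
  refine ⟨hS.ne, ?_⟩
  have hpos : 0 < (1 - q) * (1 + 4 * q + 10 * q ^ 2 + 18 * q ^ 3 + 24 * q ^ 4 + 18 * q ^ 5) +
      2 * q ^ 3 * (2 + 6 * q + 18 * q ^ 2 + 24 * q ^ 3) := by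
    set A := 1 + 4 * q + 10 * q ^ 2 + 18 * q ^ 3 + 24 * q ^ 4 + 18 * q ^ 5
    set B := 2 + 6 * q + 18 * q ^ 2 + 24 * q ^ 3
    have hpA : A ≤ (1 - q) * A := le_mul_of_one_le_left (by linarith) (by linarith)
    have hqB : -(8 / 125) * B ≤ q ^ 3 * B := mul_le_mul_of_nonneg_right hcube' (by linarith)
    linarith
  have hR : -2 * Sfun 5 q < Rfun 5 q := by
    rw [Sfun_five, Rfun_five]
    have := mul_pos (pow_pos hp 3) hpos
    linarith
  have hdiv : Rfun 5 q / Sfun 5 q < -2 := (div_lt_iff_of_neg hS).2 hR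
  rw [yfun]
  linarith

end
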